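/- Let g(v,p) = β·p with β > 0 (revenue-like reward). For any optimal SWAC A for a setting (n, D, g, c) there exists a fixed-rate SWAC A' for the same setting with E[A'] = E[A]. -/

import Mathlib

open MeasureTheory Filter

namespace RentalGame

/-- The *filter* of a payment schedule: the highest cumulative average payment
over all prefixes (`0` for the empty schedule). -/
noncomputable def filt (l : List ℝ) : ℝ :=
  ((List.range l.length).map (fun k => (l.take (k + 1)).sum / ((k : ℝ) + 1))).foldr max 0

/-- Utility of an agent with valuation `v` facing payment schedule `l`:
allocation times valuation minus total payment. -/
noncomputable def util (l : List ℝ) (v : ℝ) : ℝ := (l.length : ℝ) * v - l.sum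

/-- Gross seller reward `Σ_i g(v, p_i)` from schedule `l` and valuation `v`. -/
noncomputable def gross (g : ℝ → ℝ → ℝ) (v : ℝ) (l : List ℝ) : ℝ := (l.map (g v)).sum

/-- A stagewise auction with seller cost (SWAC) with `n` units and valuation set
`V ⊆ [0,∞)`.  It consists of a bidding set `B`, a payment schedule for every bid,
and the bid chosen by each agent valuation, which is required to be stagewise-IR
(its filter does not exceed the valuation) and utility-maximizing among all
allowed bids. -/
structure SWAC (n : ℕ) (V : Set ℝ) where
  B : Set ℝ
  sched : ℝ → List ℝ
  bid : ℝ → ℝ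
  len_le : ∀ b ∈ B, (sched b).length ≤ n
  pay_nonneg : ∀ b ∈ B, ∀ p ∈ sched b, 0 ≤ p
  bid_mem : ∀ v ∈ V, bid v ∈ B
  bid_IR : ∀ v ∈ V, filt (sched (bid v)) ≤ v
  bid_opt : ∀ v ∈ V, ∀ b ∈ B, filt (sched b) ≤ v →
    util (sched b) v ≤ util (sched (bid v)) v

namespace SWAC

variable {n : ℕ} {V : Set ℝ}

/-- Allocation of a bid. -/
def X (A : SWAC n V) (b : ℝ) : ℕ := (A.sched b).length

/-- Total payment of a bid. -/
noncomputable def P (A : SWAC n V) (b : ℝ) : ℝ := (A.sched b).sum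

/-- Filter of a bid. -/
noncomputable def F (A : SWAC n V) (b : ℝ) : ℝ := filt (A.sched b)

/-- Utility of valuation `v` from bid `b`. -/
noncomputable def u (A : SWAC n V) (v b : ℝ) : ℝ := util (A.sched b) v

/-- Net seller reward from valuation `v` bidding `b`, w.r.t. reward `g` and cost `c`. -/
noncomputable def r (A : SWAC n V) (g : ℝ → ℝ → ℝ) (c : ℕ → ℝ) (v b : ℝ) : ℝ :=
  gross g v (A.sched b) - c (A.X b)

/-- Net seller reward from valuation `v` under its chosen (optimal) bid. -/
noncomputable def R (A : SWAC n V) (g : ℝ → ℝ → ℝ) (c : ℕ → ℝ) (v : ℝ) : ℝ :=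
  A.r g c v (A.bid v)

/-- Allocation of valuation `v` under its chosen bid. -/
def XA (A : SWAC n V) (v : ℝ) : ℕ := A.X (A.bid v)

/-- Total payment of valuation `v` under its chosen bid. -/
noncomputable def PA (A : SWAC n V) (v : ℝ) : ℝ := A.P (A.bid v)

end SWAC

/-- Ties in the agent's utility are broken in favor of the seller,
w.r.t. reward `g` and cost `c`. -/
def TieFavor {n : ℕ} {V : Set ℝ} (g : ℝ → ℝ → ℝ) (c : ℕ → ℝ) (A : SWAC n V) : Prop :=
  ∀ v ∈ V, ∀ b ∈ A.B, filt (A.sched b) ≤ v →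
    util (A.sched b) v = util (A.sched (A.bid v)) v →
    A.r g c v b ≤ A.r g c v (A.bid v)

/-- Expected seller reward `E[A] = 𝔼_{v ∼ D}[R_A(v)]`. -/
noncomputable def ER {n : ℕ} {V : Set ℝ} (D : Measure ℝ) (g : ℝ → ℝ → ℝ) (c : ℕ → ℝ)
    (A : SWAC n V) : ℝ :=
  ∫ v, A.R g c v ∂D

/-- A SWAC is truthful if the bidding set is `V` and every agent bids its valuation. -/
def Truthful {n : ℕ} {V : Set ℝ} (A : SWAC n V) : Prop :=
  A.B = V ∧ ∀ v ∈ V, A.bid v = v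

/-- A SWAC is optimal for the setting `(n, D, g, c)` if it maximizes the expected
reward among all SWACs for this setting. -/
def Optimal {n : ℕ} {V : Set ℝ} (D : Measure ℝ) (g : ℝ → ℝ → ℝ) (c : ℕ → ℝ)
    (A : SWAC n V) : Prop :=
  TieFavor g c A ∧ ∀ A' : SWAC n V, TieFavor g c A' → ER D g c A' ≤ ER D g c A

/-- A SWAC is fixed-rate if every bid is charged the same payment on every day. -/
def FixedRate {n : ℕ} {V : Set ℝ} (A : SWAC n V) : Prop :=
  ∀ b ∈ A.B, ∃ p : ℝ, A.sched b = List.replicate (A.sched b).length p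

/-- Strong allocation monotonicity. -/
def StronglyAllocMono {n : ℕ} {V : Set ℝ} (A : SWAC n V) : Prop :=
  ∀ w ∈ V, ∀ v ∈ V, w < v → A.XA w ≤ A.XA v

/-- Allocation monotonicity, up to a `D`-null set of valuations. -/
def AllocMono {n : ℕ} {V : Set ℝ} (D : Measure ℝ) (A : SWAC n V) : Prop :=
  ∃ S : Set ℝ, D S = 0 ∧ ∀ w ∈ V \ S, ∀ v ∈ V \ S, w < v → A.XA w ≤ A.XA v

/-- Weak allocation monotonicity: up to a `D`-null set, allocation is monotone on
pairs with distinct seller rewards. -/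
def WeaklyAllocMono {n : ℕ} {V : Set ℝ} (D : Measure ℝ) (g : ℝ → ℝ → ℝ) (c : ℕ → ℝ)
    (A : SWAC n V) : Prop :=
  ∃ S : Set ℝ, D S = 0 ∧ ∀ w ∈ V \ S, ∀ v ∈ V \ S, w < v →
    A.R g c w ≠ A.R g c v → A.XA w ≤ A.XA v

/-- Reward monotonicity, up to a `D`-null set of valuations. -/
def RewardMono {n : ℕ} {V : Set ℝ} (D : Measure ℝ) (g : ℝ → ℝ → ℝ) (c : ℕ → ℝ)
    (A : SWAC n V) : Prop :=
  ∃ S : Set ℝ, D S = 0 ∧ ∀ w ∈ V \ S, ∀ v ∈ V \ S, w < v → A.R g c w ≤ A.R g c v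

lemma foldr_max_le (l : List ℝ) (v : ℝ) :
    l.foldr max 0 ≤ v ↔ 0 ≤ v ∧ ∀ a ∈ l, a ≤ v := by
  induction l with
  | nil => simp
  | cons a l ih =>
    simp only [List.foldr_cons, max_le_iff, ih, List.mem_cons, forall_eq_or_imp]
    tauto

lemma filt_le_iff (l : List ℝ) (v : ℝ) :
    filt l ≤ v ↔ 0 ≤ v ∧ ∀ k < l.length, (l.take (k + 1)).sum / ((k : ℝ) + 1) ≤ v := by
  unfold filt
  rw [foldr_max_le]
  simp

lemma util_nonneg (l : List ℝ) (v : ℝ) (h : filt l ≤ v) : 0 ≤ util l v := by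
  rw [filt_le_iff] at h
  obtain ⟨h0, h1⟩ := h
  unfold util
  rcases Nat.eq_zero_or_pos l.length with hl | hl
  · have : l = [] := List.length_eq_zero_iff.mp hl
    subst this
    simp
  · have h2 := h1 (l.length - 1) (by omega)
    have h3 : l.length - 1 + 1 = l.length := by omega
    have h4 : ((l.length - 1 : ℕ) : ℝ) + 1 = (l.length : ℝ) := by exact_mod_cast h3
    rw [h3, h4, List.take_length, div_le_iff₀ (by exact_mod_cast hl)] at h2
    linarith

lemma filt_replicate_le (k : ℕ) (p v : ℝ) (hv : 0 ≤ v) (h : 0 < k → p ≤ v) :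
    filt (List.replicate k p) ≤ v := by
  rw [filt_le_iff]
  refine ⟨hv, fun j hj => ?_⟩
  simp only [List.length_replicate] at hj
  have hm : min (j + 1) k = j + 1 := by omega
  rw [List.take_replicate, hm, List.sum_replicate, nsmul_eq_mul]
  have : (0 : ℝ) < (j : ℝ) + 1 := by positivity
  rw [div_le_iff₀ this]
  push_cast
  have := h (by omega)
  nlinarith

lemma gross_eq (g : ℝ → ℝ → ℝ) (β : ℝ) (hg : ∀ v p : ℝ, g v p = β * p) (v : ℝ) (l : List ℝ) :
    gross g v l = β * l.sum := by
  unfold gross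
  have : g v = fun p => β * p := funext (hg v)
  rw [this, List.sum_map_mul_left]
  simp

/-- A finite menu `(k, P k)`, `k ≤ K`, is implemented by a fixed-rate SWAC. -/
lemma menu_exists {n : ℕ} {V : Set ℝ} (hV : ∀ v ∈ V, 0 ≤ v)
    (D : Measure ℝ) [IsProbabilityMeasure D]
    (β : ℝ) (g : ℝ → ℝ → ℝ) (hg : ∀ v p : ℝ, g v p = β * p) (c : ℕ → ℝ)
    (K : ℕ) (hK : K ≤ n) (P : ℕ → ℝ) (hP0 : P 0 = 0) (hP : ∀ k ≤ K, 0 ≤ P k) :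
    ∃ A' : SWAC n V, FixedRate A' ∧ TieFavor g c A' ∧ Integrable (A'.R g c) D ∧
      (∀ v, ∃ k ≤ K, A'.R g c v = β * P k - c k) ∧
      ∀ v, ∀ k ≤ K, (∀ j ≤ K, (j : ℝ) * v - P j ≤ k * v - P k) →
        β * P k - c k ≤ A'.R g c v := by
  have hex : ∀ v : ℝ, ∃ k ≤ K, (∀ j ≤ K, (j : ℝ) * v - P j ≤ k * v - P k) ∧
      ∀ i ≤ K, (∀ j ≤ K, (j : ℝ) * v - P j ≤ i * v - P i) →
        β * P i - c i ≤ β * P k - c k := by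
    intro v
    obtain ⟨k, hk, hmax⟩ := Finset.exists_max_image (Finset.range (K + 1))
      (fun k => toLex ((k : ℝ) * v - P k, β * P k - c k)) ⟨0, by simp⟩
    simp only [Finset.mem_range, Nat.lt_succ_iff] at hk hmax
    have hle : ∀ j ≤ K, (j : ℝ) * v - P j ≤ k * v - P k := by
      intro j hj
      have := hmax j hj
      rw [Prod.Lex.toLex_le_toLex] at this
      rcases this with h | h
      · exact h.le
      · exact h.1.le
    refine ⟨k, hk, hle, fun i hi hi2 => ?_⟩
    have h1 := hmax i hi
    have h2 := hi2 k hk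
    rw [Prod.Lex.toLex_le_toLex] at h1
    rcases h1 with h | h
    · exact absurd h (not_lt.mpr h2)
    · exact h.2
  choose kv hkK hku hkr using hex
  have hsum : ∀ k : ℕ, (List.replicate k (P k / k)).sum = P k := by
    intro k
    rw [List.sum_replicate, nsmul_eq_mul]
    rcases Nat.eq_zero_or_pos k with h | h
    · subst h
      simp [hP0]
    · have : (k : ℝ) ≠ 0 := by exact_mod_cast h.ne'
      field_simp
  let A' : SWAC n V :=
    { B := {b | ∃ k : ℕ, k ≤ K ∧ b = k}
      sched := fun b => List.replicate ⌊b⌋₊ (P ⌊b⌋₊ / (⌊b⌋₊ : ℕ))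
      bid := fun v => (kv v : ℝ)
      len_le := by
        rintro b ⟨k, hk, rfl⟩
        simp
        omega
      pay_nonneg := by
        rintro b ⟨k, hk, rfl⟩ p hp
        rw [Nat.floor_natCast] at hp
        rw [List.eq_of_mem_replicate hp]
        exact div_nonneg (hP k hk) (by positivity)
      bid_mem := fun v _ => ⟨kv v, hkK v, rfl⟩
      bid_IR := by
        intro v hv
        rw [Nat.floor_natCast]
        refine filt_replicate_le _ _ _ (hV v hv) (fun hpos => ?_)
        have h := hku v 0 (Nat.zero_le _)
        rw [hP0] at h
        rw [div_le_iff₀ (by exact_mod_cast hpos)]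
        push_cast at h
        linarith
      bid_opt := by
        rintro v hv b ⟨k, hk, rfl⟩ _
        unfold util
        rw [Nat.floor_natCast, Nat.floor_natCast, hsum, hsum, List.length_replicate,
          List.length_replicate]
        exact hku v k hk }
  have hr : ∀ v (k : ℕ), A'.r g c v k = β * P k - c k := by
    intro v k
    unfold SWAC.r SWAC.X
    rw [gross_eq g β hg]
    simp only [A']
    rw [Nat.floor_natCast, hsum, List.length_replicate]
  have hR : ∀ v, A'.R g c v = β * P (kv v) - c (kv v) := fun v => hr v (kv v)
  have hbest : ∀ v, ∀ k ≤ K, (∀ j ≤ K, (j : ℝ) * v - P j ≤ k * v - P k) →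
        β * P k - c k ≤ A'.R g c v := by
    intro v k hk h
    rw [hR]
    exact hkr v k hk h
  refine ⟨A', ?_, ?_, ?_, fun v => ⟨kv v, hkK v, hR v⟩, hbest⟩
  · rintro b ⟨k, hk, rfl⟩
    refine ⟨P k / k, ?_⟩
    simp only [A']
    rw [Nat.floor_natCast, List.length_replicate]
  · rintro v hv b ⟨k, hk, rfl⟩ _ hu
    rw [hr]
    refine hbest v k hk (fun j hj => ?_)
    unfold util at hu
    simp only [A'] at hu
    rw [Nat.floor_natCast, Nat.floor_natCast, hsum, hsum, List.length_replicate,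
          List.length_replicate] at hu
    rw [hu]
    exact hku v j hj
  · have hmeas : Measurable (A'.R g c) := by
      apply measurable_of_Ici
      intro a
      have : A'.R g c ⁻¹' Set.Ici a = ⋃ k ∈ {k : ℕ | k ≤ K ∧ a ≤ β * P k - c k},
          ⋂ j ∈ {j : ℕ | j ≤ K}, {v : ℝ | (j : ℝ) * v - P j ≤ k * v - P k} := by
        ext v
        simp only [Set.mem_preimage, Set.mem_Ici, Set.mem_iUnion, Set.mem_iInter,
          Set.mem_setOf_eq, exists_prop]
        constructor
        · intro h
          rw [hR] at h
          exact ⟨kv v, ⟨hkK v, h⟩, hku v⟩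
        · rintro ⟨k, ⟨hk, hk2⟩, h⟩
          exact hk2.trans (hbest v k hk h)
      rw [this]
      refine MeasurableSet.biUnion (Set.to_countable _) (fun k _ => ?_)
      refine MeasurableSet.biInter (Set.to_countable _) (fun j _ => ?_)
      exact measurableSet_le (by fun_prop) (by fun_prop)
    refine Integrable.of_bound hmeas.aestronglyMeasurable
      (∑ k ∈ Finset.range (K + 1), |β * P k - c k|) (Filter.Eventually.of_forall fun v => ?_)
    rw [hR, Real.norm_eq_abs]
    exact Finset.single_le_sum (f := fun k => |β * P k - c k|) (fun _ _ => abs_nonneg _)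
      (Finset.mem_range.mpr (Nat.lt_succ_of_le (hkK v)))

/-- Downward incentive compatibility. -/
lemma downward_IC {n : ℕ} {V : Set ℝ} (A : SWAC n V) (v w : ℝ) (hv : v ∈ V) (hw : w ∈ V)
    (hwv : w ≤ v) :
    util (A.sched (A.bid w)) w + (A.XA w : ℝ) * (v - w) ≤ util (A.sched (A.bid v)) v := by
  have h := A.bid_opt v hv (A.bid w) (A.bid_mem w hw) ((A.bid_IR w hw).trans hwv)
  unfold SWAC.XA SWAC.X
  unfold util at *
  linarith

/-- The agent's utility dominates the information rent of the running-maximum allocation. -/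
lemma rent_bound {n : ℕ} {V : Set ℝ} (A : SWAC n V) (hV : ∀ v ∈ V, 0 ≤ v) (k : ℕ) :
    ∀ v ∈ V, (∃ w ∈ V, w ≤ v ∧ k ≤ A.XA w) →
      ∑ j ∈ Finset.range k, (v - sInf {w | w ∈ V ∧ j < A.XA w})
        ≤ util (A.sched (A.bid v)) v := by
  induction k with
  | zero =>
    intro v hv _
    simpa using util_nonneg _ _ (A.bid_IR v hv)
  | succ k ih =>
    rintro v hv ⟨w, hw, hwv, hkw⟩
    have key : ∀ z ∈ V, z ≤ v → k < A.XA z →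
        ∑ j ∈ Finset.range k, (v - sInf {w | w ∈ V ∧ j < A.XA w}) + (v - z)
          ≤ util (A.sched (A.bid v)) v := by
      intro z hz hzv hkz
      have h1 := downward_IC A v z hv hz hzv
      have h2 := ih z hz ⟨z, hz, le_rfl, hkz.le⟩
      have h3 : ((k : ℝ) + 1) * (v - z) ≤ (A.XA z : ℝ) * (v - z) := by
        apply mul_le_mul_of_nonneg_right _ (by linarith)
        exact_mod_cast hkz
      simp only [Finset.sum_sub_distrib, Finset.sum_const, Finset.card_range,
        nsmul_eq_mul] at h2 ⊢
      linarith
    rw [Finset.sum_range_succ]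
    have hne : {w | w ∈ V ∧ k < A.XA w}.Nonempty := ⟨w, hw, hkw⟩
    have : v - (util (A.sched (A.bid v)) v
        - ∑ j ∈ Finset.range k, (v - sInf {w | w ∈ V ∧ j < A.XA w}))
        ≤ sInf {w | w ∈ V ∧ k < A.XA w} := by
      refine le_csInf hne ?_
      rintro z ⟨hz, hkz⟩
      rcases le_total z v with h | h
      · have := key z hz h hkz
        linarith
      · have := key w hw hwv hkw
        linarith
    linarith

/-- For a revenue-like reward `g(v,p) = β·p` with `β > 0`, for any
optimal SWAC `A` for a setting `(n, D, g, c)` there exists a fixed-rate SWAC `A'`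
for the same setting with `E[A'] = E[A]`. -/
theorem revenue_like_fixed_rate_wlog
    {n : ℕ} {V : Set ℝ} (hV : ∀ v ∈ V, 0 ≤ v)
    (D : Measure ℝ) [IsProbabilityMeasure D] (hDsupp : D Vᶜ = 0)
    (β : ℝ) (hβ : 0 < β)
    (g : ℝ → ℝ → ℝ) (hg : ∀ v p : ℝ, g v p = β * p)
    (c : ℕ → ℝ) (hc0 : c 0 = 0) (hcmono : Monotone c) (hcnn : ∀ x, 0 ≤ c x)
    (A : SWAC n V) (hopt : Optimal D g c A) :
    ∃ A' : SWAC n V, FixedRate A' ∧ TieFavor g c A' ∧ ER D g c A' = ER D g c A := by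
  have hVne : V.Nonempty := by
    by_contra h
    rw [Set.not_nonempty_iff_eq_empty] at h
    subst h
    simp at hDsupp
  by_cases hint : Integrable (A.R g c) D
  swap
  · obtain ⟨A', h1, h2, _, h4, _⟩ := menu_exists (n := n) hV D β g hg c 0 (Nat.zero_le _)
      (fun _ => 0) rfl (fun _ _ => le_rfl)
    refine ⟨A', h1, h2, ?_⟩
    unfold ER
    rw [integral_undef hint]
    have : A'.R g c = fun _ => 0 := by
      funext v
      obtain ⟨k, hk, h⟩ := h4 v
      rw [h, Nat.le_zero.mp hk, hc0]
      simp
    rw [this]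
    simp
  have hXn : ∀ v ∈ V, A.XA v ≤ n := fun v hv => A.len_le _ (A.bid_mem v hv)
  -- the efficient allocation below the running maximum
  have hex : ∀ v : ℝ, ∃ k : ℕ, v ∈ V → (∃ w ∈ V, w ≤ v ∧ k ≤ A.XA w) ∧
      ∀ i, (∃ w ∈ V, w ≤ v ∧ i ≤ A.XA w) → β * (i * v) - c i ≤ β * (k * v) - c k ∧
        (k < i → β * (i * v) - c i < β * (k * v) - c k) := by
    intro v
    by_cases hv : v ∈ V
    swap
    · exact ⟨0, fun h => absurd h hv⟩
    classical
    obtain ⟨k, hk, hmax⟩ := Finset.exists_max_image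
      ((Finset.range (n + 1)).filter (fun i => ∃ w ∈ V, w ≤ v ∧ i ≤ A.XA w))
      (fun k : ℕ => toLex (β * (k * v) - c k, k))
      ⟨0, by simp; exact ⟨v, hv, le_rfl⟩⟩
    simp only [Finset.mem_filter, Finset.mem_range, Nat.lt_succ_iff] at hk hmax
    refine ⟨k, fun _ => ⟨hk.2, fun i hi => ?_⟩⟩
    have hin : i ≤ n := by
      obtain ⟨w, hw, _, h⟩ := hi
      exact h.trans (hXn w hw)
    have := hmax i ⟨hin, hi⟩
    rw [Prod.Lex.toLex_le_toLex] at this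
    rcases this with h | h
    · exact ⟨h.le, fun _ => h⟩
    · refine ⟨h.1.le, fun h2 => ?_⟩
      have h3 : i ≤ k := h.2
      omega
  choose x hx using hex
  have hxn : ∀ v ∈ V, x v ≤ n := by
    intro v hv
    obtain ⟨w, hw, _, h⟩ := (hx v hv).1
    exact h.trans (hXn w hw)
  have hxmono : ∀ v ∈ V, ∀ w ∈ V, v ≤ w → x v ≤ x w := by
    intro v hv w hw hvw
    by_contra hlt
    push Not at hlt
    obtain ⟨z, hz, hzv, hxz⟩ := (hx v hv).1
    have h1 := ((hx w hw).2 (x v) ⟨z, hz, hzv.trans hvw, hxz⟩).2 hlt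
    have h2 := ((hx v hv).2 (x w) ⟨z, hz, hzv, hlt.le.trans hxz⟩).1
    have h3 : (x w : ℝ) ≤ x v := by exact_mod_cast hlt.le
    have h4 : 0 ≤ β * (((x v : ℝ) - x w) * (w - v)) :=
      mul_nonneg hβ.le (mul_nonneg (by linarith) (by linarith))
    nlinarith
  obtain ⟨K, hKn, ⟨v0, hv0, hxv0⟩, hKx⟩ : ∃ K ≤ n, (∃ v0 ∈ V, x v0 = K) ∧ ∀ v ∈ V, x v ≤ K := by
    have hbdd : BddAbove (x '' V) := ⟨n, by rintro _ ⟨v, hv, rfl⟩; exact hxn v hv⟩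
    have hmem := Nat.sSup_mem (hVne.image x) hbdd
    obtain ⟨v0, hv0, h⟩ := hmem
    exact ⟨sSup (x '' V), h ▸ hxn v0 hv0, ⟨v0, hv0, h⟩,
      fun v hv => le_csSup hbdd ⟨v, hv, rfl⟩⟩
  -- thresholds
  let τ : ℕ → ℝ := fun j => sInf {w | w ∈ V ∧ j < x w}
  have hτne : ∀ j < K, {w | w ∈ V ∧ j < x w}.Nonempty := fun j hj => ⟨v0, hv0, hxv0 ▸ hj⟩
  have hτ0 : ∀ j, 0 ≤ τ j := fun j => Real.sInf_nonneg (fun w hw => hV w hw.1)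
  have hτle : ∀ v ∈ V, ∀ j < x v, τ j ≤ v := fun v hv j hj =>
    csInf_le ⟨0, fun w hw => hV w hw.1⟩ ⟨hv, hj⟩
  have hτge : ∀ v ∈ V, ∀ j < K, x v ≤ j → v ≤ τ j := by
    intro v hv j hj hxj
    refine le_csInf (hτne j hj) ?_
    rintro w ⟨hw, hjw⟩
    by_contra hlt
    push Not at hlt
    have := hxmono w hw v hv hlt.le
    omega
  have htτ : ∀ j < K, sInf {w | w ∈ V ∧ j < A.XA w} ≤ τ j := by
    intro j hj
    refine le_csInf (hτne j hj) ?_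
    rintro w ⟨hw, hjw⟩
    obtain ⟨z, hz, hzw, hxz⟩ := (hx w hw).1
    have hbdd : BddBelow {w | w ∈ V ∧ j < A.XA w} := ⟨0, fun w hw => hV w hw.1⟩
    exact (csInf_le hbdd ⟨hz, hjw.trans_le hxz⟩).trans hzw
  let P : ℕ → ℝ := fun k => ∑ j ∈ Finset.range k, τ j
  have hPu : ∀ (k : ℕ) (v : ℝ), (k : ℝ) * v - P k = ∑ j ∈ Finset.range k, (v - τ j) := by
    intro k v
    simp [P, Finset.sum_sub_distrib]
  obtain ⟨A', h1, h2, h3, _, h5⟩ := menu_exists (n := n) hV D β g hg c K hKn P (by simp [P])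
    (fun k _ => Finset.sum_nonneg (fun j _ => hτ0 j))
  refine ⟨A', h1, h2, le_antisymm (hopt.2 A' h2) ?_⟩
  unfold ER
  refine integral_mono_ae hint h3 ?_
  have hae : ∀ᵐ v ∂D, v ∈ V := hDsupp
  filter_upwards [hae] with v hv
  have hmax : ∀ j ≤ K, (j : ℝ) * v - P j ≤ x v * v - P (x v) := by
    intro j hj
    rw [hPu, hPu]
    rcases le_total j (x v) with h | h
    · refine Finset.sum_le_sum_of_subset_of_nonneg (Finset.range_mono h) (fun i hi _ => ?_)
      have := hτle v hv i (Finset.mem_range.mp hi)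
      linarith
    · rw [← Finset.sum_range_add_sum_Ico _ h]
      have : ∑ i ∈ Finset.Ico (x v) j, (v - τ i) ≤ 0 := by
        refine Finset.sum_nonpos (fun i hi => ?_)
        rw [Finset.mem_Ico] at hi
        have := hτge v hv i (by omega) hi.1
        linarith
      linarith
  have h6 := h5 v (x v) (hKx v hv) hmax
  refine le_trans ?_ h6
  have h7 := rent_bound A hV (x v) v hv (hx v hv).1
  have h8 : (x v : ℝ) * v - P (x v) ≤ util (A.sched (A.bid v)) v := by
    rw [hPu]
    refine le_trans (Finset.sum_le_sum fun j hj => ?_) h7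
    have := htτ j ((Finset.mem_range.mp hj).trans_le (hKx v hv))
    linarith
  have h9 := ((hx v hv).2 (A.XA v) ⟨v, hv, le_rfl, le_rfl⟩).1
  unfold SWAC.R SWAC.r
  rw [gross_eq g β hg]
  unfold util at h8
  unfold SWAC.XA SWAC.X at h9
  unfold SWAC.X
  have h10 := mul_le_mul_of_nonneg_left h8 hβ.le
  nlinarith

end RentalGame
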